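/- Let u ∈ C̃²(T³) solve the reduced Calabi–Yau equation (u_xx + 1)(u_yy + u_tt + u_t + 1) − u_xy² − u_xt² = e^F with F continuous and 1-periodic. Then ‖u‖_{L²} ≤ |1 + e^F|_{C⁰}, i.e. (∫_{[0,1]³} u² dV)^{1/2} ≤ sup_{ℝ³} (1 + e^F). -/

import Mathlib

open MeasureTheory

noncomputable section

/-- Points of `ℝ³`, written as `ℝ × ℝ × ℝ`. -/
abbrev R3 := ℝ × ℝ × ℝ

/-- The coordinate direction `x`. -/
def vx : R3 := (1, 0, 0)
/-- The coordinate direction `y`. -/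
def vy : R3 := (0, 1, 0)
/-- The coordinate direction `t`. -/
def vt : R3 := (0, 0, 1)

/-- Partial (directional) derivative in the direction `e`. -/
def pd (e : R3) (u : R3 → ℝ) : R3 → ℝ := fun p => fderiv ℝ u p e

/-- `1`-periodicity in each of the three variables. -/
def Periodic3 (u : R3 → ℝ) : Prop :=
  ∀ p : R3, u (p + vx) = u p ∧ u (p + vy) = u p ∧ u (p + vt) = u p

/-- The unit cube `[0,1]³`. -/
def cube : Set R3 := Set.Icc (0, 0, 0) (1, 1, 1)

/-- Zero mean over the unit cube. -/
def ZeroMean (u : R3 → ℝ) : Prop := ∫ p in cube, u p = 0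

/-- The reduced Calabi–Yau equation
`(u_xx + 1)(u_yy + u_tt + u_t + 1) − u_xy² − u_xt² = e^F` on `ℝ³`. -/
def CYeq (F u : R3 → ℝ) : Prop :=
  ∀ p : R3,
    (pd vx (pd vx u) p + 1)
        * (pd vy (pd vy u) p + pd vt (pd vt u) p + pd vt u p + 1)
      - (pd vy (pd vx u) p) ^ 2 - (pd vt (pd vx u) p) ^ 2 = Real.exp (F p)

/-- The Euclidean norm on `ℝ³ = ℝ × ℝ × ℝ`. -/
def enorm3 (h : R3) : ℝ := Real.sqrt (h.1 ^ 2 + h.2.1 ^ 2 + h.2.2 ^ 2)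

theorem volume_cube : (volume : Measure R3).real cube = 1 := by
  have : cube = Set.Icc (0 : ℝ) 1 ×ˢ (Set.Icc (0 : ℝ) 1 ×ˢ Set.Icc (0 : ℝ) 1) := by
    simp [cube]
  rw [this, Measure.volume_eq_prod, measureReal_prod_prod, Measure.volume_eq_prod,
    measureReal_prod_prod]
  simp

theorem isCompact_cube : IsCompact cube := isCompact_Icc

theorem Continuous.integrableOn_cube {g : R3 → ℝ} (hg : Continuous g) : IntegrableOn g cube :=
  hg.continuousOn.integrableOn_compact isCompact_cube

theorem integral_cube_const (c : ℝ) : ∫ _ in cube, c = c := by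
  simp [volume_cube]

/-- The integral over the cube as an iterated integral. -/
theorem integral_cube_eq {g : R3 → ℝ} (hg : Continuous g) :
    ∫ p in cube, g p = ∫ x in (0 : ℝ)..1, ∫ y in (0 : ℝ)..1, ∫ t in (0 : ℝ)..1, g (x, y, t) := by
  have hc : cube = Set.Icc (0 : ℝ) 1 ×ˢ (Set.Icc (0 : ℝ) 1 ×ˢ Set.Icc (0 : ℝ) 1) := by
    simp [cube]
  have hi := hg.integrableOn_cube
  rw [hc, Measure.volume_eq_prod] at *
  rw [setIntegral_prod _ hi, intervalIntegral.integral_of_le zero_le_one,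
    integral_Icc_eq_integral_Ioc]
  congr 1
  ext x
  have hx : Continuous fun q : ℝ × ℝ => g (x, q) := by fun_prop
  have hxi : IntegrableOn (fun q : ℝ × ℝ => g (x, q))
      (Set.Icc (0 : ℝ) 1 ×ˢ Set.Icc (0 : ℝ) 1) (volume.prod volume) :=
    hx.continuousOn.integrableOn_compact (isCompact_Icc.prod isCompact_Icc)
  rw [Measure.volume_eq_prod, setIntegral_prod _ hxi, intervalIntegral.integral_of_le zero_le_one,
    integral_Icc_eq_integral_Ioc]
  congr 1
  ext y
  rw [intervalIntegral.integral_of_le zero_le_one, integral_Icc_eq_integral_Ioc]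

theorem integral_zero_one_add {f : ℝ → ℝ} (hf : Function.Periodic f 1) (a : ℝ) :
    ∫ x in (0 : ℝ)..1, f (x + a) = ∫ x in (0 : ℝ)..1, f x := by
  rw [intervalIntegral.integral_comp_add_right]
  have := hf.intervalIntegral_add_eq a 0
  simpa [add_comm] using this

namespace Periodic3

variable {f g : R3 → ℝ}

/-- Integrals over the cube of continuous periodic functions are translation invariant. -/
theorem integral_add (hg : Continuous g) (hp : Periodic3 g) (w : R3) :
    ∫ p in cube, g (p + w) = ∫ p in cube, g p := by
  obtain ⟨a, b, c⟩ := w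
  rw [integral_cube_eq hg, integral_cube_eq (by fun_prop)]
  simp only [Prod.mk_add_mk]
  have h1 (x y : ℝ) : ∫ t in (0 : ℝ)..1, g (x, y, t + c) = ∫ t in (0 : ℝ)..1, g (x, y, t) :=
    integral_zero_one_add (f := fun t => g (x, y, t))
      (fun t => by simpa [vt] using (hp (x, y, t)).2.2) c
  have h2 (x : ℝ) : ∫ y in (0 : ℝ)..1, ∫ t in (0 : ℝ)..1, g (x, y + b, t) =
      ∫ y in (0 : ℝ)..1, ∫ t in (0 : ℝ)..1, g (x, y, t) :=
    integral_zero_one_add (f := fun y => ∫ t in (0 : ℝ)..1, g (x, y, t))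
      (fun y => by
        refine intervalIntegral.integral_congr fun t _ => ?_
        simpa [vy] using (hp (x, y, t)).2.1) b
  simp only [h1, h2]
  exact integral_zero_one_add
    (f := fun x => ∫ y in (0 : ℝ)..1, ∫ t in (0 : ℝ)..1, g (x, y, t))
    (fun x => by
      refine intervalIntegral.integral_congr fun y _ => intervalIntegral.integral_congr fun t _ => ?_
      simpa [vx] using (hp (x, y, t)).1) a

theorem mul (hf : Periodic3 f) (hg : Periodic3 g) : Periodic3 fun p => f p * g p := fun p => by
  simp [hf p, hg p]

theorem sub (hf : Periodic3 f) (hg : Periodic3 g) : Periodic3 fun p => f p - g p := fun p => by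
  simp [hf p, hg p]

theorem comp_add (hf : Periodic3 f) (w : R3) : Periodic3 fun p => f (p + w) := fun p => by
  simp only [add_right_comm _ _ w]
  exact hf (p + w)

theorem pd (hf : Periodic3 f) (e : R3) : Periodic3 (pd e f) := by
  have key (v : R3) (h : ∀ p, f (p + v) = f p) (p : R3) : _root_.pd e f (p + v) = _root_.pd e f p := by
    rw [_root_.pd, ← fderiv_comp_add_right, funext h, _root_.pd]
  exact fun p => ⟨key _ (fun q => (hf q).1) p, key _ (fun q => (hf q).2.1) p,
    key _ (fun q => (hf q).2.2) p⟩

end Periodic3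

theorem ContDiff.continuous_pd {f : R3 → ℝ} (hf : ContDiff ℝ 1 f) (e : R3) :
    Continuous (pd e f) :=
  (hf.continuous_fderiv one_ne_zero).clm_apply continuous_const

theorem ContDiff.contDiff_pd {f : R3 → ℝ} (hf : ContDiff ℝ 2 f) (e : R3) :
    ContDiff ℝ 1 (pd e f) :=
  (hf.fderiv_right (m := 1) (by norm_num)).clm_apply contDiff_const

theorem pd_mul {f g : R3 → ℝ} (hf : ContDiff ℝ 1 f) (hg : ContDiff ℝ 1 g) (e p : R3) :
    pd e (fun q => f q * g q) p = f p * pd e g p + g p * pd e f p := by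
  simp only [pd]
  rw [fderiv_fun_mul (hf.differentiable one_ne_zero p) (hg.differentiable one_ne_zero p)]
  simp

theorem pd_neg_left (f : R3 → ℝ) (e p : R3) : pd (-e) f p = -pd e f p := by
  simp [pd]

theorem pd_comm {f : R3 → ℝ} (hf : ContDiff ℝ 2 f) (d e p : R3) :
    pd d (pd e f) p = pd e (pd d f) p := by
  have hd : DifferentiableAt ℝ (fderiv ℝ f) p :=
    ((hf.fderiv_right (m := 1) (by norm_num)).differentiable one_ne_zero) p
  have key (a b : R3) : pd a (pd b f) p = fderiv ℝ (fderiv ℝ f) p a b := by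
    change fderiv ℝ (fun q => fderiv ℝ f q b) p a = _
    rw [fderiv_clm_apply hd (by fun_prop)]
    simp
  rw [key, key]
  exact (hf.contDiffAt.isSymmSndFDerivAt (by simp)) d e

theorem hasDerivAt_comp_add_smul {g : R3 → ℝ} (hg : ContDiff ℝ 1 g) (p v : R3) (s : ℝ) :
    HasDerivAt (fun s : ℝ => g (p + s • v)) (pd v g (p + s • v)) s := by
  have h1 : HasDerivAt (fun s : ℝ => p + s • v) v s := by
    simpa using ((hasDerivAt_id s).smul_const v).const_add p
  exact ((hg.differentiable one_ne_zero _).hasFDerivAt).comp_hasDerivAt s h1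

/-- Differentiation of `∫ f · g(· + s v)` at `s = 0`. -/
theorem hasDerivAt_integral_mul_comp_add {f g : R3 → ℝ} (hf : Continuous f)
    (hg : ContDiff ℝ 1 g) (v : R3) :
    HasDerivAt (fun s : ℝ => ∫ p in cube, f p * g (p + s • v))
      (∫ p in cube, f p * pd v g p) 0 := by
  have hgc := hg.continuous
  have hpc := hg.continuous_pd v
  have hK : IsCompact (Set.Icc (-1 : ℝ) 1 ×ˢ cube) := isCompact_Icc.prod isCompact_cube
  obtain ⟨C, hC⟩ := hK.exists_bound_of_continuousOn
    (f := fun z : ℝ × R3 => f z.2 * pd v g (z.2 + z.1 • v)) (by fun_prop)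
  have := (hasDerivAt_integral_of_dominated_loc_of_deriv_le (μ := volume.restrict cube)
    (F := fun (s : ℝ) p => f p * g (p + s • v))
    (F' := fun (s : ℝ) p => f p * pd v g (p + s • v)) (x₀ := 0) (s := Set.Icc (-1) 1)
    (bound := fun _ => C) (Icc_mem_nhds (by norm_num) (by norm_num)) ?_ ?_ ?_ ?_ ?_ ?_).2
  · simpa using this
  · exact Filter.Eventually.of_forall fun s =>
      Continuous.aestronglyMeasurable (by fun_prop)
  · exact Continuous.integrableOn_cube (by fun_prop)
  · exact Continuous.aestronglyMeasurable (by fun_prop)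
  · exact ae_restrict_of_forall_mem isCompact_cube.measurableSet
      fun p hp s hs => hC (s, p) ⟨hs, hp⟩
  · exact Continuous.integrableOn_cube (by fun_prop)
  · exact Filter.Eventually.of_forall fun p s _ =>
      (hasDerivAt_comp_add_smul hg p v s).const_mul (f p)

theorem integral_pd_eq_zero {g : R3 → ℝ} (hg : ContDiff ℝ 1 g) (hp : Periodic3 g) (v : R3) :
    ∫ p in cube, pd v g p = 0 := by
  have h := hasDerivAt_integral_mul_comp_add (f := fun _ => 1) continuous_const hg v
  simp only [one_mul, hp.integral_add hg.continuous] at h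
  exact h.unique (hasDerivAt_const _ _)

theorem integral_mul_pd_add_eq_zero {f g : R3 → ℝ} (hf : ContDiff ℝ 1 f) (hg : ContDiff ℝ 1 g)
    (hfp : Periodic3 f) (hgp : Periodic3 g) (v : R3) :
    ∫ p in cube, (f p * pd v g p + g p * pd v f p) = 0 := by
  rw [← integral_pd_eq_zero (hf.mul hg) (hfp.mul hgp) v]
  exact integral_congr_ae (Filter.Eventually.of_forall fun p => (pd_mul hf hg v p).symm)

/-- The Jacobian `f_d g_e - f_e g_d` of two `C¹` periodic functions has zero integral. -/
theorem integral_jacobian_eq_zero {f g : R3 → ℝ} (hf : ContDiff ℝ 1 f) (hg : ContDiff ℝ 1 g)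
    (hfp : Periodic3 f) (hgp : Periodic3 g) (d e : R3) :
    ∫ p in cube, (pd d f p * pd e g p - pd e f p * pd d g p) = 0 := by
  have hfc := hf.continuous
  have hgc := hg.continuous
  have hfd := hf.continuous_pd d
  have hfe := hf.continuous_pd e
  have hgd := hg.continuous_pd d
  have hge := hg.continuous_pd e
  have h1 := hasDerivAt_integral_mul_comp_add hfd hg e
  have h2 := hasDerivAt_integral_mul_comp_add hgd hf (-e)
  have heq (s : ℝ) : ∫ p in cube, pd d f p * g (p + s • e) =
      -∫ p in cube, pd d g p * f (p + s • (-e)) := by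
    have hgs : ContDiff ℝ 1 fun p => g (p + s • e) := by fun_prop
    have h3 := integral_mul_pd_add_eq_zero hf hgs hfp (hgp.comp_add _) d
    have h4 (p : R3) : pd d (fun p => g (p + s • e)) p = pd d g (p + s • e) := by
      simp only [pd, fderiv_comp_add_right]
    simp only [h4] at h3
    rw [integral_add (Continuous.integrableOn_cube (by fun_prop))
      (Continuous.integrableOn_cube (by fun_prop))] at h3
    have h5 := Periodic3.integral_add (g := fun p => pd d g p * f (p + s • (-e))) (by fun_prop)
      ((hgp.pd d).mul (hfp.comp_add _)) (s • e)
    have h6 (p : R3) : p + s • e + s • (-e) = p := by simp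
    simp only [h6] at h5
    simp only [mul_comm (f _), mul_comm (g _)] at h3
    linarith
  simp only [heq] at h1
  have h7 := h1.unique h2.neg
  simp only [pd_neg_left, mul_neg, integral_neg, neg_neg] at h7
  rw [integral_sub (Continuous.integrableOn_cube (by fun_prop))
      (Continuous.integrableOn_cube (by fun_prop)), h7]
  simp only [mul_comm, sub_self]

theorem sq_integral_le_integral_sq {k : ℝ → ℝ} (hk : Continuous k) :
    (∫ s in (0 : ℝ)..1, k s) ^ 2 ≤ ∫ s in (0 : ℝ)..1, k s ^ 2 := by
  set m := ∫ s in (0 : ℝ)..1, k s with hm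
  have h : 0 ≤ ∫ s in (0 : ℝ)..1, (k s - m) ^ 2 :=
    intervalIntegral.integral_nonneg zero_le_one fun s _ => sq_nonneg _
  have h2 : ∫ s in (0 : ℝ)..1, (k s - m) ^ 2 =
      (∫ s in (0 : ℝ)..1, k s ^ 2) - 2 * m * m + m ^ 2 := by
    have : ∀ s, (k s - m) ^ 2 = k s ^ 2 - 2 * m * k s + m ^ 2 := fun s => by ring
    simp only [this]
    rw [intervalIntegral.integral_add, intervalIntegral.integral_sub,
      intervalIntegral.integral_const_mul, ← hm]
    · simp
    all_goals exact Continuous.intervalIntegrable (by fun_prop) _ _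
  nlinarith

theorem integral_sq_comp_add_sub_le {u : R3 → ℝ} (hu : ContDiff ℝ 1 u) (hp : Periodic3 u)
    (h : R3) :
    ∫ p in cube, (u (p + h) - u p) ^ 2 ≤ ∫ p in cube, (pd h u p) ^ 2 := by
  have huc := hu.continuous
  have hpc := hu.continuous_pd h
  have hpt (p : R3) : (u (p + h) - u p) ^ 2 ≤ ∫ s in (0 : ℝ)..1, pd h u (p + s • h) ^ 2 := by
    have h1 := intervalIntegral.integral_eq_sub_of_hasDerivAt (a := 0) (b := 1)
      (fun s _ => hasDerivAt_comp_add_smul hu p h s)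
      (Continuous.intervalIntegrable (by fun_prop) _ _)
    simp only [one_smul, zero_smul, add_zero] at h1
    rw [← h1]
    exact sq_integral_le_integral_sq (by fun_prop)
  have hcont : Continuous fun p : R3 => ∫ s in (0 : ℝ)..1, pd h u (p + s • h) ^ 2 :=
    intervalIntegral.continuous_parametric_intervalIntegral_of_continuous' (by fun_prop) _ _
  calc
    _ ≤ ∫ p in cube, ∫ s in (0 : ℝ)..1, pd h u (p + s • h) ^ 2 :=
      integral_mono (Continuous.integrableOn_cube (by fun_prop)) hcont.integrableOn_cube hpt
    _ = ∫ s in (0 : ℝ)..1, ∫ p in cube, pd h u (p + s • h) ^ 2 := by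
      simp only [intervalIntegral.integral_of_le zero_le_one, ← integral_Icc_eq_integral_Ioc]
      refine integral_integral_swap ?_
      rw [Measure.prod_restrict]
      exact ContinuousOn.integrableOn_compact (isCompact_cube.prod isCompact_Icc) (by fun_prop)
    _ = _ := by
      have h2 (s : ℝ) := Periodic3.integral_add (g := fun p => pd h u p ^ 2) (by fun_prop)
        (by simpa only [sq] using (hp.pd h).mul (hp.pd h)) (s • h)
      simp [h2]

/-- A Poincaré inequality on the torus. -/
theorem integral_sq_le_of_zeroMean {u : R3 → ℝ} (hu : ContDiff ℝ 1 u) (hp : Periodic3 u)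
    (hm : ZeroMean u) :
    2 * ∫ p in cube, u p ^ 2 ≤
      3 / 4 * ∫ p in cube, (pd vx u p ^ 2 + pd vy u p ^ 2 + pd vt u p ^ 2) := by
  have huc := hu.continuous
  have hxc := hu.continuous_pd vx
  have hyc := hu.continuous_pd vy
  have htc := hu.continuous_pd vt
  set m : R3 := (1 / 2, 1 / 2, 1 / 2)
  set S := ∫ p in cube, u p ^ 2
  set N := ∫ p in cube, (pd vx u p ^ 2 + pd vy u p ^ 2 + pd vt u p ^ 2)
  have hsq : Periodic3 fun p => u p ^ 2 := by simpa only [sq] using hp.mul hp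
  have hq : ∀ q ∈ cube, 2 * S - 3 / 4 * N ≤ 2 * ∫ p in cube, u p * u (q + (p - m)) := by
    intro q hq
    have h1 := integral_sq_comp_add_sub_le hu hp (q - m)
    have h2 : ∫ p in cube, (u (p + (q - m)) - u p) ^ 2 =
        S + S - 2 * ∫ p in cube, u p * u (q + (p - m)) := by
      have : ∀ p, (u (p + (q - m)) - u p) ^ 2 =
          u (p + (q - m)) ^ 2 + u p ^ 2 - 2 * (u p * u (q + (p - m))) := fun p => by
        rw [show q + (p - m) = p + (q - m) by abel]
        ring
      simp only [this]
      rw [integral_sub, MeasureTheory.integral_add, integral_const_mul,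
        Periodic3.integral_add (g := fun p => u p ^ 2) (by fun_prop) hsq]
      all_goals exact Continuous.integrableOn_cube (by fun_prop)
    have h3 : ∫ p in cube, pd (q - m) u p ^ 2 ≤ 3 / 4 * N := by
      rw [← integral_const_mul]
      refine integral_mono
        (Continuous.integrableOn_cube ((hu.continuous_pd _).pow 2))
        (Continuous.integrableOn_cube (by fun_prop)) fun p => ?_
      obtain ⟨q1, q2, q3⟩ := q
      have e : ((q1, q2, q3) - m : R3) =
          (q1 - 1 / 2) • vx + (q2 - 1 / 2) • vy + (q3 - 1 / 2) • vt := by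
        simp [m, vx, vy, vt]
      simp only [e, pd, map_add, map_smul, smul_eq_mul]
      simp only [cube, Set.mem_Icc, Prod.mk_le_mk] at hq
      obtain ⟨⟨h1, h2, h3⟩, h4, h5, h6⟩ := hq
      generalize fderiv ℝ u p vx = a
      generalize fderiv ℝ u p vy = b
      generalize fderiv ℝ u p vt = c
      have sq1 : (q1 - 1 / 2) ^ 2 ≤ 1 / 4 := by nlinarith
      have sq2 : (q2 - 1 / 2) ^ 2 ≤ 1 / 4 := by nlinarith
      have sq3 : (q3 - 1 / 2) ^ 2 ≤ 1 / 4 := by nlinarith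
      generalize q1 - 1 / 2 = r at *
      generalize q2 - 1 / 2 = s at *
      generalize q3 - 1 / 2 = t at *
      calc
        (r * a + s * b + t * c) ^ 2 ≤ (r ^ 2 + s ^ 2 + t ^ 2) * (a ^ 2 + b ^ 2 + c ^ 2) := by
          nlinarith [sq_nonneg (r * b - s * a), sq_nonneg (r * c - t * a),
            sq_nonneg (s * c - t * b)]
        _ ≤ _ := mul_le_mul_of_nonneg_right (by linarith) (by positivity)
    linarith
  have hswap : ∫ q in cube, ∫ p in cube, u p * u (q + (p - m)) = 0 := by
    rw [integral_integral_swap]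
    · have : ∀ p, ∫ q in cube, u p * u (q + (p - m)) = 0 := fun p => by
        rw [integral_const_mul, hp.integral_add huc, show ∫ q in cube, u q = 0 from hm, mul_zero]
      simp [this]
    · rw [Measure.prod_restrict]
      exact ContinuousOn.integrableOn_compact (isCompact_cube.prod isCompact_cube) (by fun_prop)
  have hcont : Continuous fun q : R3 => ∫ p in cube, u p * u (q + (p - m)) :=
    continuous_parametric_integral_of_continuous (by fun_prop) isCompact_cube
  have := setIntegral_mono_on (Continuous.integrableOn_cube continuous_const)
    (Continuous.integrableOn_cube (hcont.const_mul 2)) isCompact_cube.measurableSet hq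
  rw [integral_cube_const, integral_const_mul, hswap] at this
  linarith

/-- Ellipticity: along a solution `u_xx + 1` is positive. -/
theorem CYeq.pd_pd_add_one_pos {F u : R3 → ℝ} (hu : ContDiff ℝ 2 u) (huper : Periodic3 u)
    (hsol : CYeq F u) (p : R3) : 0 < pd vx (pd vx u) p + 1 := by
  have hc := (hu.contDiff_pd vx).continuous_pd vx
  have hne (q : R3) : pd vx (pd vx u) q + 1 ≠ 0 := fun h0 => by
    have := hsol q
    rw [h0] at this
    nlinarith [Real.exp_pos (F q), sq_nonneg (pd vy (pd vx u) q), sq_nonneg (pd vt (pd vx u) q)]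
  obtain ⟨q, hq⟩ : ∃ q, 0 ≤ pd vx (pd vx u) q + 1 := by
    by_contra! hneg
    have h1 : ∫ q in cube, (pd vx (pd vx u) q + 1) ≤ 0 :=
      integral_nonpos fun q => (hneg q).le
    rw [MeasureTheory.integral_add hc.integrableOn_cube
      (Continuous.integrableOn_cube continuous_const), integral_cube_const,
      integral_pd_eq_zero (hu.contDiff_pd vx) (huper.pd vx)] at h1
    norm_num at h1
  by_contra! hp
  obtain ⟨r, hr⟩ := mem_range_of_exists_le_of_exists_ge
    (f := fun q => pd vx (pd vx u) q + 1) (c := 0) (by fun_prop) ⟨p, hp⟩ ⟨q, hq⟩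
  exact hne r hr

theorem quadratic_form_nonneg {A₁ A₂ b c x y t : ℝ} (h₁ : 0 < A₁)
    (h : 0 ≤ A₁ * A₂ - b ^ 2 - c ^ 2) :
    0 ≤ A₂ * x ^ 2 + A₁ * (y ^ 2 + t ^ 2) - 2 * b * x * y - 2 * c * x * t := by
  refine (mul_nonneg_iff_of_pos_left h₁).1 ?_
  have : A₁ * (A₂ * x ^ 2 + A₁ * (y ^ 2 + t ^ 2) - 2 * b * x * y - 2 * c * x * t) =
    x ^ 2 * (A₁ * A₂ - b ^ 2 - c ^ 2) + (A₁ * y - b * x) ^ 2 + (A₁ * t - c * x) ^ 2 := by ring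
  rw [this]
  positivity

/-- Continuous functions whose integral over the cube vanishes. -/
def NullIntegral (Z : R3 → ℝ) : Prop := Continuous Z ∧ ∫ p in cube, Z p = 0

namespace NullIntegral

variable {f g : R3 → ℝ}

theorem add (hf : NullIntegral f) (hg : NullIntegral g) : NullIntegral fun p => f p + g p := by
  refine ⟨hf.1.add hg.1, ?_⟩
  rw [MeasureTheory.integral_add hf.1.integrableOn_cube hg.1.integrableOn_cube, hf.2, hg.2,
    add_zero]

theorem const_mul (hf : NullIntegral f) (c : ℝ) : NullIntegral fun p => c * f p := by
  refine ⟨hf.1.const_mul c, ?_⟩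
  rw [integral_const_mul, hf.2, mul_zero]

end NullIntegral

/-- The energy estimate obtained by testing the equation with `u`. -/
theorem CYeq.integral_gradient_sq_le {F u : R3 → ℝ} (hF : Continuous F) (hu : ContDiff ℝ 2 u)
    (huper : Periodic3 u) (hsol : CYeq F u) :
    ∫ p in cube, (pd vx u p ^ 2 + pd vy u p ^ 2 + pd vt u p ^ 2) ≤
      2 * ∫ p in cube, u p * (1 - Real.exp (F p)) := by
  have hu1 : ContDiff ℝ 1 u := hu.of_le (by norm_num)
  have hx := hu.contDiff_pd vx
  have hy := hu.contDiff_pd vy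
  have ht := hu.contDiff_pd vt
  have px := huper.pd vx
  have py := huper.pd vy
  have pt := huper.pd vt
  have c0 := hu.continuous
  have cx := hx.continuous
  have cy := hy.continuous
  have ct := ht.continuous
  have cxx := hx.continuous_pd vx
  have cxy := hx.continuous_pd vy
  have cxt := hx.continuous_pd vt
  have cyy := hy.continuous_pd vy
  have ctt := ht.continuous_pd vt
  have sxy := pd_comm hu vx vy
  have sxt := pd_comm hu vx vt
  have z1 := integral_mul_pd_add_eq_zero hu1 hx huper px vx
  have z2 := integral_mul_pd_add_eq_zero hu1 hy huper py vy
  have z3 := integral_mul_pd_add_eq_zero hu1 ht huper pt vt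
  have z4 := integral_mul_pd_add_eq_zero hu1 hu1 huper huper vt
  have z5 := integral_jacobian_eq_zero (hu1.mul hx) hy (huper.mul px) py vx vy
  have z6 := integral_jacobian_eq_zero (hu1.mul hy) hx (huper.mul py) px vy vx
  have z7 := integral_jacobian_eq_zero (hu1.mul hx) ht (huper.mul px) pt vx vt
  have z8 := integral_jacobian_eq_zero (hu1.mul ht) hx (huper.mul pt) px vt vx
  have z9 := integral_mul_pd_add_eq_zero (hu1.mul ht) hx (huper.mul pt) px vx
  have z10 := integral_mul_pd_add_eq_zero hu1 (hx.mul hx) huper (px.mul px) vt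
  simp only [pd_mul hu1 hx, pd_mul hu1 hy, pd_mul hu1 ht, pd_mul hx hx, sxy, sxt] at *
  have null {Z : R3 → ℝ} (hZ : ∫ p in cube, Z p = 0) (hc : Continuous Z) : NullIntegral Z :=
    ⟨hc, hZ⟩
  have w1 := null z1 (by fun_prop)
  have w2 := null z2 (by fun_prop)
  have w3 := null z3 (by fun_prop)
  have w4 := null z4 (by fun_prop)
  have w5 := null z5 (by fun_prop)
  have w6 := null z6 (by fun_prop)
  have w7 := null z7 (by fun_prop)
  have w8 := null z8 (by fun_prop)
  have w9 := null z9 (by fun_prop)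
  have w10 := null z10 (by fun_prop)
  have w := (((((w1.add w2).add w3).add (w4.const_mul (1 / 2))).add
    ((((w5.add w6).add w7).add w8).const_mul (1 / 2))).add w9).add (w10.const_mul (-1 / 2))
  have hle := integral_mono (μ := volume.restrict cube)
    (f := fun p => 1 / 2 * (pd vx u p ^ 2 + pd vy u p ^ 2 + pd vt u p ^ 2))
    (Continuous.integrableOn_cube (by fun_prop))
    ((Continuous.integrableOn_cube (g := fun p => u p * (1 - Real.exp (F p)))
      (by fun_prop)).add w.1.integrableOn_cube) fun p => by
      have heq := hsol p
      have hpos := hsol.pd_pd_add_one_pos hu huper p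
      have hq := quadratic_form_nonneg (x := pd vx u p) (y := pd vy u p) (t := pd vt u p) hpos
        (heq ▸ (Real.exp_pos (F p)).le)
      simp only [Pi.add_apply, ← heq]
      linarith
  simp only [Pi.add_apply] at hle
  rw [MeasureTheory.integral_add (Continuous.integrableOn_cube (by fun_prop))
    w.1.integrableOn_cube, w.2, integral_const_mul] at hle
  linarith

/-- The `L²` estimate `‖u‖_{L²} ≤ |1 + e^F|_{C⁰}` for solutions of
the reduced Calabi–Yau equation (`B` being any uniform bound on `|1 + e^F|`). -/
theorem stmt8 (F u : R3 → ℝ) (hF : Continuous F) (hFper : Periodic3 F)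
    (hu : ContDiff ℝ 2 u) (huper : Periodic3 u) (humean : ZeroMean u)
    (hsol : CYeq F u)
    (B : ℝ) (hB : ∀ p : R3, |1 + Real.exp (F p)| ≤ B) :
    Real.sqrt (∫ p in cube, (u p) ^ 2) ≤ B := by
  have hu1 : ContDiff ℝ 1 u := hu.of_le (by norm_num)
  have c0 := hu.continuous
  have hpoinc := integral_sq_le_of_zeroMean hu1 huper humean
  have henergy := hsol.integral_gradient_sq_le hF hu huper
  have hB0 : 0 ≤ B := (abs_nonneg _).trans (hB 0)
  have hmono : ∫ p in cube, u p * (1 - Real.exp (F p)) ≤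
      ∫ p in cube, (1 / 2 * u p ^ 2 + 1 / 2 * B ^ 2) := by
    refine integral_mono (Continuous.integrableOn_cube (by fun_prop))
      (Continuous.integrableOn_cube (by fun_prop)) fun p => ?_
    have h1 := (le_abs_self _).trans (hB p)
    have h2 := Real.exp_pos (F p)
    nlinarith [sq_nonneg (u p - (1 - Real.exp (F p)))]
  rw [MeasureTheory.integral_add (Continuous.integrableOn_cube (by fun_prop))
    (Continuous.integrableOn_cube continuous_const), integral_const_mul,
    integral_cube_const] at hmono
  refine Real.sqrt_le_iff.2 ⟨hB0, ?_⟩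
  nlinarith [sq_nonneg B]

end
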